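/- If the TU game (N, v) is superadditive, then every hyperedge e of a directed hypergraph game (N, v, E) is stable with respect to the Myerson value: μ_k(N, v, E) ≥ μ_k(N, v, E \ {e}) for every player k ∈ A_e ∪ B_e. -/

import Mathlib

open Finset

variable {N : Type*} [DecidableEq N] [Fintype N]

/-- The Shapley value of player `i` in the TU game `v`. -/
noncomputable def Shapley (v : Finset N → ℝ) (i : N) : ℝ :=
  ∑ S ∈ (Finset.univ.erase i).powerset,
    ((Nat.factorial S.card * Nat.factorial (Fintype.card N - S.card - 1) : ℝ) /
      Nat.factorial (Fintype.card N)) * (v (insert i S) - v S)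

/-- A directed hyperedge: a pair of nonempty disjoint tail and head sets. -/
abbrev DHyperedge (N : Type*) [DecidableEq N] :=
  {p : Finset N × Finset N // p.1.Nonempty ∧ p.2.Nonempty ∧ Disjoint p.1 p.2}

/-- Tail set of a directed hyperedge. -/
def DHyperedge.tail (e : DHyperedge N) : Finset N := e.1.1

/-- Head set of a directed hyperedge. -/
def DHyperedge.head (e : DHyperedge N) : Finset N := e.1.2

/-- All players belonging to a directed hyperedge. -/
def DHyperedge.vert (e : DHyperedge N) : Finset N := e.1.1 ∪ e.1.2

/-- One step of a directed path: some hyperedge of `E` has `u` in its tail and `w` in its head. -/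
def step (E : Finset (DHyperedge N)) (u w : N) : Prop :=
  ∃ e ∈ E, u ∈ e.tail ∧ w ∈ e.head

/-- Two players are connected if there are directed paths in both directions. -/
def conn (E : Finset (DHyperedge N)) (u w : N) : Prop :=
  Relation.ReflTransGen (step E) u w ∧ Relation.ReflTransGen (step E) w u

/-- Hyperedges of `E` all of whose players lie in the coalition `S`. -/
def edgesIn (E : Finset (DHyperedge N)) (S : Finset N) : Finset (DHyperedge N) :=
  E.filter (fun e => e.vert ⊆ S)

open scoped Classical in
/-- The strong components of the subhypergraph induced on `S` (i.e. `S/E_S`). -/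
noncomputable def components (E : Finset (DHyperedge N)) (S : Finset N) : Finset (Finset N) :=
  S.image (fun i => S.filter (fun j => conn (edgesIn E S) i j))

/-- The directed-hypergraph-restricted game `v^E`. -/
noncomputable def restricted (v : Finset N → ℝ) (E : Finset (DHyperedge N)) (S : Finset N) : ℝ :=
  ∑ T ∈ components E S, v T

/-- The Myerson value of the directed hypergraph game `(N, v, E)`. -/
noncomputable def myerson (v : Finset N → ℝ) (E : Finset (DHyperedge N)) (i : N) : ℝ :=
  Shapley (restricted v E) i

/-- A hyperedge is a bridge if the strong component containing it splits upon its deletion. -/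
def IsBridge (E : Finset (DHyperedge N)) (e : DHyperedge N) : Prop :=
  e ∈ E ∧ ∃ T ∈ components E Finset.univ,
    e.vert ⊆ T ∧ T ∉ components (E.erase e) Finset.univ

/-- A hyperedge is safe if deleting it does not increase any player's Myerson payoff. -/
def Safe (v : Finset N → ℝ) (E : Finset (DHyperedge N)) (e : DHyperedge N) : Prop :=
  ∀ k : N, myerson v (E.erase e) k ≤ myerson v E k

/-- An allocation rule on directed hypergraph games on the player set `N`. -/
abbrev AllocRule (N : Type*) [DecidableEq N] [Fintype N] :=
  (Finset N → ℝ) → Finset (DHyperedge N) → N → ℝ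

/-- Strong component efficiency of an allocation rule. -/
def StrongComponentEfficient (f : AllocRule N) : Prop :=
  ∀ (v : Finset N → ℝ) (E : Finset (DHyperedge N)), v ∅ = 0 →
    ∀ T ∈ components E Finset.univ, ∑ i ∈ T, f v E i = v T

/-- Fairness of an allocation rule. -/
def Fair (f : AllocRule N) : Prop :=
  ∀ (v : Finset N → ℝ) (E : Finset (DHyperedge N)), v ∅ = 0 →
    ∀ e ∈ E, ∀ i ∈ e.tail, ∀ j ∈ e.head,
      f v E i - f v (E.erase e) i = f v E j - f v (E.erase e) j

section

variable {M : Type*} [DecidableEq M]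

theorem conn.refl (E : Finset (DHyperedge M)) (u : M) : conn E u u :=
  ⟨.refl, .refl⟩

theorem conn.symm {E : Finset (DHyperedge M)} {u w : M} (h : conn E u w) : conn E w u :=
  ⟨h.2, h.1⟩

theorem conn.trans {E : Finset (DHyperedge M)} {u w x : M} (h : conn E u w) (h' : conn E w x) :
    conn E u x :=
  ⟨h.1.trans h'.1, h'.2.trans h.2⟩

theorem conn.mono {E F : Finset (DHyperedge M)} (hEF : E ⊆ F) {u w : M} (h : conn E u w) :
    conn F u w :=
  have hstep : ∀ a b, step E a b → step F a b := fun _ _ ⟨e, he, h⟩ => ⟨e, hEF he, h⟩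
  ⟨Relation.ReflTransGen.mono hstep _ _ h.1, Relation.ReflTransGen.mono hstep _ _ h.2⟩

theorem mem_components {E : Finset (DHyperedge M)} {S T : Finset M} :
    T ∈ components E S ↔
      ∃ i ∈ S, ∀ j, j ∈ T ↔ j ∈ S ∧ conn (edgesIn E S) i j := by
  simp only [components, Finset.mem_image, Finset.ext_iff, Finset.mem_filter]
  exact exists_congr fun i => and_congr_right fun _ => forall_congr' fun j => Iff.comm

theorem nonempty_of_mem_components {E : Finset (DHyperedge M)} {S T : Finset M}
    (hT : T ∈ components E S) : T.Nonempty := by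
  obtain ⟨i, hi, h⟩ := mem_components.1 hT
  exact ⟨i, (h i).2 ⟨hi, .refl _ _⟩⟩

theorem eq_of_mem_components {E : Finset (DHyperedge M)} {S T U : Finset M}
    (hT : T ∈ components E S) (hU : U ∈ components E S) {x : M} (hxT : x ∈ T) (hxU : x ∈ U) :
    T = U := by
  obtain ⟨i, -, hi⟩ := mem_components.1 hT
  obtain ⟨j, -, hj⟩ := mem_components.1 hU
  have hij := ((hi x).1 hxT).2.trans ((hj x).1 hxU).2.symm
  ext y
  rw [hi, hj]
  exact and_congr_right fun _ => ⟨hij.symm.trans, hij.trans⟩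

theorem exists_mem_components {E : Finset (DHyperedge M)} {S : Finset M} {x : M} (hx : x ∈ S) :
    ∃ T ∈ components E S, x ∈ T := by
  classical
  refine ⟨S.filter (conn (edgesIn E S) x), mem_components.2 ⟨x, hx, by simp⟩, ?_⟩
  simp [hx, conn.refl]

theorem subset_of_mem_components {E : Finset (DHyperedge M)} {S T : Finset M}
    (hT : T ∈ components E S) : T ⊆ S := by
  obtain ⟨i, -, hi⟩ := mem_components.1 hT
  exact fun x hx => ((hi x).1 hx).1

theorem edgesIn_mono {E F : Finset (DHyperedge M)} (hEF : E ⊆ F) (S : Finset M) :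
    edgesIn E S ⊆ edgesIn F S :=
  Finset.filter_subset_filter _ hEF

/-- A component for fewer hyperedges lies in every component for more hyperedges that it meets. -/
theorem subset_of_mem_components_of_subset {E F : Finset (DHyperedge M)} (hEF : E ⊆ F)
    {S T U : Finset M} (hT : T ∈ components E S) (hU : U ∈ components F S) {x : M}
    (hxT : x ∈ T) (hxU : x ∈ U) : T ⊆ U := by
  obtain ⟨i, -, hi⟩ := mem_components.1 hT
  obtain ⟨j, -, hj⟩ := mem_components.1 hU
  intro y hy
  have hxy := (((hi x).1 hxT).2.symm.trans ((hi y).1 hy).2).mono (edgesIn_mono hEF S)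
  exact (hj y).2 ⟨((hi y).1 hy).1, ((hj x).1 hxU).2.trans hxy⟩

theorem sum_le_of_superadditive {v : Finset M → ℝ} (h0 : v ∅ = 0)
    (hsa : ∀ S T : Finset M, Disjoint S T → v S + v T ≤ v (S ∪ T)) (P : Finset (Finset M))
    (hP : (P : Set (Finset M)).PairwiseDisjoint id) : ∑ T ∈ P, v T ≤ v (P.biUnion id) := by
  induction P using Finset.induction_on with
  | empty => simp [h0]
  | insert T P hT ih =>
    rw [Finset.coe_insert, Set.pairwiseDisjoint_insert_of_notMem (by simpa using hT)] at hP
    rw [Finset.sum_insert hT, Finset.biUnion_insert]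
    have hdisj : Disjoint T (P.biUnion id) :=
      (Finset.disjoint_biUnion_right _ _ _).2 fun U hU => hP.2 U hU
    have := hsa T (P.biUnion id) hdisj
    have := ih hP.1
    simp only [id] at *
    linarith

theorem restricted_mono {v : Finset M → ℝ} (h0 : v ∅ = 0)
    (hsa : ∀ S T : Finset M, Disjoint S T → v S + v T ≤ v (S ∪ T))
    {E F : Finset (DHyperedge M)} (hEF : E ⊆ F) (S : Finset M) :
    restricted v E S ≤ restricted v F S := by
  have hcover : components E S =
      (components F S).biUnion fun U => (components E S).filter (· ⊆ U) := by
    ext T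
    simp only [Finset.mem_biUnion, Finset.mem_filter]
    refine ⟨fun hT => ?_, fun ⟨_, _, hT, _⟩ => hT⟩
    obtain ⟨x, hx⟩ := nonempty_of_mem_components hT
    obtain ⟨U, hU, hxU⟩ := exists_mem_components (E := F) (subset_of_mem_components hT hx)
    exact ⟨U, hU, hT, subset_of_mem_components_of_subset hEF hT hU hx hxU⟩
  rw [restricted, restricted, hcover, Finset.sum_biUnion]
  · refine Finset.sum_le_sum fun U hU => ?_
    have hunion : ((components E S).filter (· ⊆ U)).biUnion id = U := by
      ext x
      simp only [Finset.mem_biUnion, Finset.mem_filter, id]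
      refine ⟨fun ⟨T, ⟨_, hTU⟩, hx⟩ => hTU hx, fun hx => ?_⟩
      obtain ⟨T, hT, hxT⟩ := exists_mem_components (E := E) (subset_of_mem_components hU hx)
      exact ⟨T, ⟨hT, subset_of_mem_components_of_subset hEF hT hU hxT hx⟩, hxT⟩
    refine (sum_le_of_superadditive h0 hsa _ fun T hT T' hT' hne => ?_).trans_eq (by rw [hunion])
    rw [Function.onFun, Finset.disjoint_left]
    exact fun x hx hx' => hne (eq_of_mem_components (Finset.mem_filter.1 hT).1
      (Finset.mem_filter.1 hT').1 hx hx')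
  · intro U hU U' hU' hne
    rw [Function.onFun, Finset.disjoint_left]
    intro T hT hT'
    rw [Finset.mem_filter] at hT hT'
    obtain ⟨x, hx⟩ := nonempty_of_mem_components hT.1
    exact hne (eq_of_mem_components hU hU' (hT.2 hx) (hT'.2 hx))

theorem edgesIn_erase {E : Finset (DHyperedge M)} {e : DHyperedge M} {S : Finset M}
    (h : ¬ e.vert ⊆ S) : edgesIn (E.erase e) S = edgesIn E S := by
  rw [edgesIn, edgesIn, Finset.filter_erase, Finset.erase_eq_of_notMem]
  simp [h]

theorem restricted_erase (v : Finset M → ℝ) {E : Finset (DHyperedge M)} {e : DHyperedge M}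
    {S : Finset M} (h : ¬ e.vert ⊆ S) : restricted v (E.erase e) S = restricted v E S := by
  rw [restricted, restricted, components, components, edgesIn_erase h]

end

/-- For a superadditive game, every hyperedge is stable with respect to the Myerson value. -/
theorem hyperedge_stable_of_superadditive (v : Finset N → ℝ) (h0 : v ∅ = 0)
    (hsa : ∀ S T : Finset N, Disjoint S T → v S + v T ≤ v (S ∪ T))
    (E : Finset (DHyperedge N)) (e : DHyperedge N) (he : e ∈ E) :
    ∀ k ∈ e.tail ∪ e.head, myerson v (E.erase e) k ≤ myerson v E k := by
  intro k hk
  refine Finset.sum_le_sum fun S hS => mul_le_mul_of_nonneg_left ?_ (by positivity)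
  have hkS : k ∉ S := fun h => by simpa using Finset.mem_powerset.1 hS h
  rw [restricted_erase v fun h => hkS (h hk)]
  exact sub_le_sub_right (restricted_mono h0 hsa (Finset.erase_subset e E) _) _
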